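/- Let k be a field of characteristic 3 and f(x) = x^9 + a_7 x^7 + a_6 x^6 + a_4 x^4 + a_3 x^3 + x. If a_3 a_4^2 = -1, a_7 = a_6 = 0, then disc(f) = a_3^3 a_4^6 + 1 = 0. -/

import Mathlib

open Polynomial Matrix

/-- Discriminant of a (monic) degree-9 polynomial, defined as the determinant of the
17×17 Sylvester matrix of `f` (formal degree 9) and its derivative (formal degree 8).
For monic `f` of degree 9 this equals the discriminant, since `(-1)^(9·8/2) = 1`. -/
noncomputable def disc9 {k : Type*} [Field k] (f : Polynomial k) : k :=
  (Matrix.of fun i j : Fin 17 =>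
    if (i : ℕ) < 8 then
      (if (j : ℕ) ≤ (i : ℕ) + 9 then f.coeff (9 + (i : ℕ) - (j : ℕ)) else 0)
    else
      (if (j : ℕ) ≤ (i : ℕ) then (Polynomial.derivative f).coeff ((i : ℕ) - (j : ℕ)) else 0)).det

/-- Pairing a shifted row of coefficients with the vector of descending powers of `r` evaluates
the polynomial at `r`, up to a power of `r`. -/
theorem sum_shifted_coeff_mul_pow {R : Type*} [CommRing R] (p : R[X]) (r : R) {m N : ℕ}
    (hp : p.natDegree ≤ m) (hm : m ≤ N) :
    ∑ j : Fin (N + 1), (if (j : ℕ) ≤ m then p.coeff (m - j) else 0) * r ^ (N - (j : ℕ)) =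
      r ^ (N - m) * p.eval r := by
  rw [Fin.sum_univ_eq_sum_range
      (fun j => (if j ≤ m then p.coeff (m - j) else 0) * r ^ (N - j)) (N + 1),
    ← Finset.sum_subset (Finset.range_subset_range.mpr (Nat.succ_le_succ hm)),
    eval_eq_sum_range' (Nat.lt_succ_of_le hp), Finset.mul_sum, ← Finset.sum_range_reflect]
  · refine Finset.sum_congr rfl fun j hj => ?_
    have hj' : j ≤ m := Nat.lt_succ_iff.mp (Finset.mem_range.mp hj)
    have h1 : m.succ - 1 - j ≤ m := by omega
    have h2 : m - (m.succ - 1 - j) = j := by omega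
    have h3 : N - (m.succ - 1 - j) = N - m + j := by omega
    rw [if_pos h1, h2, h3, pow_add]
    ring
  · intro j _ hj
    have hj' : ¬ j ≤ m := by simpa [Nat.lt_succ_iff] using hj
    rw [if_neg hj', zero_mul]

/-- `disc9` vanishes at a polynomial that shares a root with its derivative. -/
theorem disc9_eq_zero_of_isRoot {k : Type*} [Field k] {f : k[X]} (hf : f.natDegree ≤ 9) {r : k}
    (hr : f.eval r = 0) (hr' : (derivative f).eval r = 0) : disc9 f = 0 := by
  unfold disc9
  apply Matrix.exists_mulVec_eq_zero_iff.mp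
  refine ⟨fun j => r ^ (16 - (j : ℕ)), fun hv => ?_, ?_⟩
  · simpa using congrFun hv 16
  · ext i
    have hi' := i.isLt
    simp only [Matrix.mulVec, dotProduct, Matrix.of_apply, Pi.zero_apply]
    by_cases hi : (i : ℕ) < 8
    · simp only [if_pos hi, add_comm 9 (i : ℕ)]
      rw [sum_shifted_coeff_mul_pow f r (by omega) (by omega), hr, mul_zero]
    · have hd := natDegree_derivative_le f
      simp only [if_neg hi]
      rw [sum_shifted_coeff_mul_pow (derivative f) r (by omega) (by omega), hr', mul_zero]

/-- char 3, `f = x^9 + a_4x^4 + a_3x^3 + x` (i.e. `a_7 = a_6 = 0`).  If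
`a_3a_4² = -1` then `disc(f) = a_3³a_4⁶ + 1 = 0`. -/
theorem stmt7 {k : Type*} [Field k] [IsAlgClosed k] [CharP k 3]
    (a3 a4 : k) (h : a3 * a4 ^ 2 = -1)
    (f : k[X])
    (hf : f = X ^ 9 + C a4 * X ^ 4 + C a3 * X ^ 3 + X) :
    disc9 f = a3 ^ 3 * a4 ^ 6 + 1 ∧ disc9 f = 0 := by
  have h3 : (3 : k) = 0 := by exact_mod_cast CharP.cast_eq_zero k 3
  have ha4 : a4 ≠ 0 := by
    rintro rfl
    simp at h
  have hcube : a3 ^ 3 * a4 ^ 6 + 1 = 0 := by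
    linear_combination ((a3 * a4 ^ 2) ^ 2 - a3 * a4 ^ 2 + 1) * h
  have hdet : disc9 f = 0 := by
    obtain ⟨r, hr⟩ := IsAlgClosed.exists_pow_nat_eq (-a4⁻¹) (n := 3) (by norm_num)
    have hder : a4 * r ^ 3 + 1 = 0 := by
      rw [hr]
      field_simp
      ring
    have hroot : r ^ 9 + a4 * r ^ 4 + a3 * r ^ 3 + r = 0 := by
      have hr9 : r ^ 9 + a3 * r ^ 3 = 0 := by
        have hpow : r ^ 9 = (r ^ 3) ^ 3 := by ring
        rw [hpow, hr]
        field_simp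
        linear_combination -h
      linear_combination hr9 + r * hder
    refine disc9_eq_zero_of_isRoot (r := r) ?_ ?_ ?_
    · rw [hf]
      compute_degree!
    · simpa [hf] using hroot
    · simp only [hf, derivative_add, derivative_X_pow, derivative_C_mul, derivative_X, eval_add,
        eval_mul, eval_C, eval_pow, eval_X, eval_one, Nat.cast_ofNat]
      linear_combination hder + (3 * r ^ 8 + a4 * r ^ 3 + a3 * r ^ 2) * h3
  exact ⟨hdet.trans hcube.symm, hdet⟩
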